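/- Let T : [0,1]^m → [0,1]^m be continuous. Then T has a fixed point. -/

import Mathlib

/-- A surjection from a finite set onto a set with one element less has exactly two points whose
removal preserves surjectivity. -/
theorem Finset.exists_pair_image_erase_eq {α β : Type*} [DecidableEq α] [DecidableEq β]
    {A : Finset α} {B : Finset β} {f : α → β} (h : A.image f = B) (hcard : A.card = B.card + 1) :
    ∃ a ∈ A, ∃ b ∈ A, a ≠ b ∧ ∀ x ∈ A, (A.erase x).image f = B ↔ x = a ∨ x = b := by
  obtain ⟨a, ha, b, hb, hab, hf⟩ := Finset.exists_ne_map_eq_of_card_lt_of_maps_to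
    (by omega : B.card < A.card) (f := f) (fun x hx => by
      rw [← h]; exact Finset.mem_coe.2 (Finset.mem_image_of_mem f hx))
  refine ⟨a, ha, b, hb, hab, fun x hx => ⟨fun hxB => ?_, ?_⟩⟩
  · by_contra! hne
    have hinj : Set.InjOn f (A.erase x) := Finset.card_image_iff.1 (by
      rw [hxB, Finset.card_erase_of_mem hx]; omega)
    exact hab (hinj (by simp [ha, hne.1.symm]) (by simp [hb, hne.2.symm]) hf)
  · rintro (rfl | rfl)
    all_goals
      rw [← h]
      ext z
      simp only [Finset.mem_image, Finset.mem_erase]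
      constructor
      · rintro ⟨y, hy, rfl⟩
        exact ⟨y, hy.2, rfl⟩
      · rintro ⟨y, hy, rfl⟩
        grind

namespace Scarf

variable {I X L : Type*} [LinearOrder L]

/-- A finite set is dominant for a family of orders (given by the keys `r i`) if no point lies
strictly above one of its points in every order. -/
def Dominant (r : I → X → L) (S : Finset X) : Prop :=
  ∀ y, ∃ i, ∀ x ∈ S, r i y ≤ r i x

/-- The point `y` lies strictly above `m l` in the order `l`, for all `l ≠ k`. -/
def Above (r : I → X → L) (m : I → X) (k : I) (y : X) : Prop :=
  ∀ l, l ≠ k → r l (m l) < r l y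

/-- The point `x` is the greatest one, in the order `k`, among the points above `m` off `k`. -/
def IsTop (r : I → X → L) (m : I → X) (k : I) (x : X) : Prop :=
  Above r m k x ∧ ∀ y, Above r m k y → r k y ≤ r k x

variable {r : I → X → L} {m : I → X} {τ : Finset X}

theorem IsTop.eq (hr : ∀ i, Function.Injective (r i)) {k : I} {x y : X}
    (hx : IsTop r m k x) (hy : IsTop r m k y) : x = y :=
  hr k (le_antisymm (hy.2 x hx.1) (hx.2 y hy.1))

theorem exists_isTop [Finite X] {k : I} {y : X} (hy : Above r m k y) : ∃ x, IsTop r m k x := by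
  obtain ⟨x, hx, hmax⟩ := Set.exists_max_image {y | Above r m k y} (r k) (Set.toFinite _) ⟨y, hy⟩
  exact ⟨x, hx, hmax⟩

theorem Dominant.le_of_above (hτ : Dominant r τ) (hm : ∀ i, m i ∈ τ) {k : I} {x : X}
    (hx : Above r m k x) : ∀ z ∈ τ, r k x ≤ r k z := by
  obtain ⟨l, hl⟩ := hτ x
  by_cases h : l = k
  · exact h ▸ hl
  · exact absurd (hl _ (hm l)) (not_le.2 (hx l h))

theorem Dominant.image_eq [Fintype I] [DecidableEq X] (hr : ∀ i, Function.Injective (r i))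
    (hτ : Dominant r τ) (hm : ∀ i, m i ∈ τ) (hmin : ∀ i, ∀ z ∈ τ, r i (m i) ≤ r i z) :
    Finset.univ.image m = τ := by
  ext z
  simp only [Finset.mem_image, Finset.mem_univ, true_and]
  refine ⟨?_, fun hz => ?_⟩
  · rintro ⟨i, rfl⟩
    exact hm i
  · obtain ⟨i, hi⟩ := hτ z
    exact ⟨i, hr i (le_antisymm (hmin i z hz) (hi _ (hm i)))⟩

theorem Dominant.insert_iff [Fintype I] [DecidableEq I] [DecidableEq X]
    (hr : ∀ i, Function.Injective (r i)) (hτ : Dominant r τ)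
    (hcard : Fintype.card I = τ.card + 1) (hm : ∀ i, m i ∈ τ)
    (hmin : ∀ i, ∀ z ∈ τ, r i (m i) ≤ r i z) (x : X) :
    x ∉ τ ∧ Dominant r (insert x τ) ↔
      ∃ k, (Finset.univ.erase k).image m = τ ∧ IsTop r m k x := by
  constructor
  · rintro ⟨hx, hdom⟩
    obtain ⟨k, hk⟩ := hdom x
    have key : ∀ z ∈ τ, ∃ l, l ≠ k ∧ m l = z ∧ r l z < r l x := by
      intro z hz
      obtain ⟨l, hl⟩ := hdom z
      have hzx : z ≠ x := fun h => hx (h ▸ hz)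
      refine ⟨l, ?_, ?_, ?_⟩
      · rintro rfl
        exact hzx (hr l (le_antisymm (hl x (by simp)) (hk z (by simp [hz]))))
      · exact hr l (le_antisymm (hmin l z hz) (hl _ (by simp [hm l])))
      · exact lt_of_le_of_ne (hl x (by simp)) fun h => hzx (hr l h)
    have himg : (Finset.univ.erase k).image m = τ := by
      ext z
      simp only [Finset.mem_image, Finset.mem_erase, Finset.mem_univ, and_true]
      refine ⟨?_, fun hz => ?_⟩
      · rintro ⟨i, -, rfl⟩
        exact hm i
      · obtain ⟨l, hl, hlz, -⟩ := key z hz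
        exact ⟨l, hl, hlz⟩
    have hinj : Set.InjOn m ((Finset.univ.erase k : Finset I)) := Finset.card_image_iff.1 (by
      rw [himg, Finset.card_erase_of_mem (Finset.mem_univ k), Finset.card_univ]; omega)
    refine ⟨k, himg, fun l hl => ?_, fun y hy => ?_⟩
    · obtain ⟨l', hl', he, hlt⟩ := key (m l) (hm l)
      have : l' = l := hinj (by simp [hl']) (by simp [hl]) he
      exact this ▸ hlt
    · obtain ⟨l, hl⟩ := hdom y
      by_cases h : l = k
      · exact h ▸ hl x (by simp)
      · exact absurd (hl (m l) (by simp [hm l])) (not_le.2 (hy l h))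
  · rintro ⟨k, himg, hx, hmax⟩
    refine ⟨fun hxτ => ?_, fun y => ?_⟩
    · rw [← himg] at hxτ
      obtain ⟨l, hl, rfl⟩ := Finset.mem_image.1 hxτ
      exact lt_irrefl _ (hx l (Finset.ne_of_mem_erase hl))
    · by_cases hy : Above r m k y
      · refine ⟨k, fun z hz => ?_⟩
        rcases Finset.mem_insert.1 hz with rfl | hz
        · exact hmax y hy
        · exact hτ.le_of_above hm hy z hz
      · simp only [Above, not_forall, not_lt] at hy
        obtain ⟨l, hl, hly⟩ := hy
        refine ⟨l, fun z hz => ?_⟩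
        rcases Finset.mem_insert.1 hz with rfl | hz
        · exact hly.trans (hx l hl).le
        · exact hly.trans (hmin l z hz)

/-- The points that complete a dominant set of `card I - 1` elements to a dominant set are the tops
of two distinct indices, and these two tops are different. -/
theorem Dominant.exists_pair [Fintype I] [DecidableEq I] [DecidableEq X]
    (hr : ∀ i, Function.Injective (r i)) (hτ : Dominant r τ)
    (hcard : Fintype.card I = τ.card + 1) (hm : ∀ i, m i ∈ τ)
    (hmin : ∀ i, ∀ z ∈ τ, r i (m i) ≤ r i z) :
    ∃ i j, i ≠ j ∧ (∀ k, (Finset.univ.erase k).image m = τ ↔ k = i ∨ k = j) ∧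
      (∀ x, x ∉ τ ∧ Dominant r (insert x τ) ↔ IsTop r m i x ∨ IsTop r m j x) ∧
      ∀ x, ¬ (IsTop r m i x ∧ IsTop r m j x) := by
  obtain ⟨i, -, j, -, hij, hpair⟩ :=
    Finset.exists_pair_image_erase_eq (hτ.image_eq hr hm hmin) (by simpa using hcard)
  refine ⟨i, j, hij, fun k => hpair k (Finset.mem_univ k), fun x => ?_, fun x hx => ?_⟩
  · rw [hτ.insert_iff hr hcard hm hmin]
    constructor
    · rintro ⟨k, hk, hkx⟩
      rcases (hpair k (Finset.mem_univ k)).1 hk with rfl | rfl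
      exacts [Or.inl hkx, Or.inr hkx]
    · rintro (h | h)
      · exact ⟨i, (hpair i (Finset.mem_univ i)).2 (Or.inl rfl), h⟩
      · exact ⟨j, (hpair j (Finset.mem_univ j)).2 (Or.inr rfl), h⟩
  · exact absurd (hτ.le_of_above hm hx.1.1 _ (hm i)) (not_le.2 (hx.2.1 i hij))

open scoped Classical in
/-- The points completing `τ` to a larger dominant set. -/
noncomputable def completions [Fintype X] (r : I → X → L) (τ : Finset X) : Finset X :=
  {x | x ∉ τ ∧ Dominant r (insert x τ)}

theorem mem_completions [Fintype X] [DecidableEq X] {x : X} :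
    x ∈ completions r τ ↔ x ∉ τ ∧ Dominant r (insert x τ) := by
  simp only [completions, Finset.mem_filter, Finset.mem_univ, true_and]
  convert Iff.rfl

/-- The points `a i` play the role of vertices at infinity: `a i` is the least point in the order
`i` and lies above all ordinary points in the other orders. -/
structure IsIdeal (r : I → X → L) (a : I → X) : Prop where
  le : ∀ i x, r i (a i) ≤ r i x
  lt : ∀ i k x, x ∉ Set.range a → k ≠ i → r i x < r i (a k)

variable {a : I → X}

theorem even_card_completions [Fintype I] [Fintype X] (hr : ∀ i, Function.Injective (r i))
    (ha : IsIdeal r a) (hτ : Dominant r τ) (hcard : Fintype.card I = τ.card + 1)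
    {p : X} (hp : p ∈ τ) (hpa : p ∉ Set.range a) : Even (completions r τ).card := by
  classical
  choose m hm hmin using fun i => Finset.exists_min_image τ (r i) ⟨p, hp⟩
  obtain ⟨i, j, hij, -, hins, hne⟩ := hτ.exists_pair hr hcard hm hmin
  have habove : ∀ k, Above r m k (a k) := fun k l hl =>
    (hmin l p hp).trans_lt (ha.lt l k p hpa hl.symm)
  obtain ⟨x, hx⟩ := exists_isTop (habove i)
  obtain ⟨y, hy⟩ := exists_isTop (habove j)
  have hxy : x ≠ y := fun h => hne x ⟨hx, h ▸ hy⟩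
  have : completions r τ = {x, y} := by
    ext z
    simp only [mem_completions, hins, Finset.mem_insert, Finset.mem_singleton]
    exact ⟨Or.imp (fun h => h.eq hr hx) (fun h => h.eq hr hy),
      Or.imp (fun h => h ▸ hx) (fun h => h ▸ hy)⟩
  rw [this, Finset.card_pair hxy]
  exact even_two

theorem IsIdeal.dominant_image_erase [Fintype I] [DecidableEq I] [DecidableEq X]
    (ha : IsIdeal r a) (p : I) : Dominant r ((Finset.univ.erase p).image a) := by
  intro y
  by_cases hy : y ∈ Set.range a
  · obtain ⟨q, rfl⟩ := hy
    exact ⟨q, fun x _ => ha.le q x⟩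
  · refine ⟨p, fun x hx => ?_⟩
    obtain ⟨k, hk, rfl⟩ := Finset.mem_image.1 hx
    exact (ha.lt p k y hy (Finset.ne_of_mem_erase hk)).le

theorem card_completions_image_erase [Fintype I] [Nontrivial I] [Fintype X] [DecidableEq I]
    [DecidableEq X] (hr : ∀ i, Function.Injective (r i)) (ha : IsIdeal r a)
    (hinj : Function.Injective a) {w : X} (hw : w ∉ Set.range a) (p : I) :
    (completions r ((Finset.univ.erase p).image a)).card = 1 := by
  classical
  set τ := (Finset.univ.erase p).image a with hτdef
  have hτ : Dominant r τ := ha.dominant_image_erase p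
  have hmem : ∀ q, q ≠ p → a q ∈ τ := fun q hq => Finset.mem_image_of_mem a (by simp [hq])
  have hcard : Fintype.card I = τ.card + 1 := by
    rw [hτdef, Finset.card_image_of_injective _ hinj, Finset.card_erase_of_mem (Finset.mem_univ p),
      Finset.card_univ]
    have := Fintype.card_pos (α := I)
    omega
  obtain ⟨q₀, hq₀⟩ := exists_ne p
  choose m hm hmin using fun i => Finset.exists_min_image τ (r i) ⟨_, hmem q₀ hq₀⟩
  have hma : ∀ q, q ≠ p → m q = a q := fun q hq =>
    hr q (le_antisymm (hmin q _ (hmem q hq)) (ha.le q _))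
  obtain ⟨i, j, hij, hpair, hins, -⟩ := hτ.exists_pair hr hcard hm hmin
  have hp : p = i ∨ p = j := (hpair p).1
    (Finset.image_congr fun q hq => hma q (Finset.ne_of_mem_erase (Finset.mem_coe.1 hq)))
  -- only the index `p` has points above `m`
  have hnot : ∀ k, k ≠ p → (Finset.univ.erase k).image m = τ → ∀ y, ¬ Above r m k y := by
    intro k hk himg y hy
    have hyτ : y ∉ τ := by
      intro hyτ
      rw [← himg] at hyτ
      obtain ⟨l, hl, rfl⟩ := Finset.mem_image.1 hyτ
      exact lt_irrefl _ (hy l (Finset.ne_of_mem_erase hl))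
    have hpy := hy p hk.symm
    have hya : y ∈ Set.range a := by
      by_contra hya
      obtain ⟨q, hq, hqm⟩ := Finset.mem_image.1 (hm p)
      have := ha.lt p q y hya (Finset.ne_of_mem_erase hq)
      rw [hqm] at this
      exact lt_asymm this hpy
    obtain ⟨q, rfl⟩ := hya
    by_cases hq : q = p
    · subst hq
      exact absurd (ha.le q (m q)) (not_le.2 hpy)
    · exact hyτ (hmem q hq)
  obtain ⟨x, hx⟩ : ∃ x, IsTop r m p x := by
    refine exists_isTop (y := w) fun l hl => ?_
    rw [hma l hl]
    exact lt_of_le_of_ne (ha.le l w) fun h => hw ⟨l, hr l h⟩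
  have : completions r τ = {x} := by
    ext z
    simp only [mem_completions, hins, Finset.mem_singleton]
    rcases hp with rfl | rfl
    · have hj := hnot j hij.symm ((hpair j).2 (Or.inr rfl))
      refine ⟨?_, fun h => Or.inl (h ▸ hx)⟩
      rintro (h | h)
      exacts [h.eq hr hx, (hj z h.1).elim]
    · have hi := hnot i hij ((hpair i).2 (Or.inl rfl))
      refine ⟨?_, fun h => Or.inr (h ▸ hx)⟩
      rintro (h | h)
      exacts [(hi z h.1).elim, h.eq hr hx]
  rw [this, Finset.card_singleton]

/-- In a set with `card I` elements that does not carry all colours, the number of elements whose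
removal leaves exactly the colours other than `i₀` is even. -/
theorem even_card_erase_image_eq [Fintype I] [DecidableEq I] [DecidableEq X] {S : Finset X}
    {c : X → I} {i₀ : I} (hS : S.card = Fintype.card I) (hc : S.image c ≠ Finset.univ) :
    Even (S.filter fun x => (S.erase x).image c = Finset.univ.erase i₀).card := by
  by_cases h : S.image c = Finset.univ.erase i₀
  · obtain ⟨x, hx, y, hy, hxy, hpair⟩ := Finset.exists_pair_image_erase_eq h (by
      rw [hS, Finset.card_erase_of_mem (Finset.mem_univ _), Finset.card_univ]
      have := Fintype.card_pos_iff.2 ⟨i₀⟩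
      omega)
    rw [Finset.filter_congr hpair, Finset.filter_or, Finset.filter_eq', Finset.filter_eq',
      if_pos hx, if_pos hy, ← Finset.insert_eq, Finset.card_pair hxy]
    exact even_two
  · rw [Finset.filter_false_of_mem]
    · simp
    · intro x hx he
      by_cases hcx : c x = i₀
      · refine hc (Finset.eq_univ_of_forall fun i => ?_)
        by_cases hi : i = i₀
        · exact Finset.mem_image.2 ⟨x, hx, hcx.trans hi.symm⟩
        · exact Finset.image_subset_image (Finset.erase_subset x S) (he ▸ by simp [hi])
      · refine h ?_
        rw [← Finset.insert_erase hx, Finset.image_insert, he, Finset.insert_eq_of_mem]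
        simp [hcx]

/-- **Scarf's lemma**: some dominant set carries all colours, if the ideal point `a i` has
colour `i`. -/
theorem exists_dominant_image_eq_univ [Fintype I] [Nontrivial I] [Fintype X] [DecidableEq I]
    (hr : ∀ i, Function.Injective (r i)) (ha : IsIdeal r a) {w : X} (hw : w ∉ Set.range a)
    {c : X → I} (hc : ∀ i, c (a i) = i) :
    ∃ S, Dominant r S ∧ S.image c = Finset.univ := by
  classical
  by_contra! hno
  obtain ⟨i₀⟩ : Nonempty I := inferInstance
  have hinj : Function.Injective a := Function.LeftInverse.injective hc
  have hpos := Fintype.card_pos (α := I)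
  set doors : Finset (Finset X) :=
    {τ | Dominant r τ ∧ Fintype.card I = τ.card + 1 ∧ τ.image c = Finset.univ.erase i₀} with hdoors
  set rooms : Finset (Finset X) := {S | Dominant r S ∧ S.card = Fintype.card I} with hrooms
  set τ₀ : Finset X := (Finset.univ.erase i₀).image a with hτ₀
  have hcard₀ : Fintype.card I = τ₀.card + 1 := by
    rw [hτ₀, Finset.card_image_of_injective _ hinj, Finset.card_erase_of_mem (Finset.mem_univ i₀),
      Finset.card_univ]
    omega
  have hmem₀ : τ₀ ∈ doors := by
    rw [hdoors, Finset.mem_filter_univ]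
    refine ⟨ha.dominant_image_erase i₀, hcard₀, ?_⟩
    rw [hτ₀, Finset.image_image, show c ∘ a = id from funext hc, Finset.image_id]
  have hcount : ∑ τ ∈ doors, (completions r τ).card =
      ∑ S ∈ rooms, (S.filter fun x => (S.erase x).image c = Finset.univ.erase i₀).card := by
    rw [← Finset.card_sigma, ← Finset.card_sigma]
    refine Finset.card_nbij' (fun q => ⟨insert q.2 q.1, q.2⟩) (fun q => ⟨q.1.erase q.2, q.2⟩)
      ?_ ?_ ?_ ?_
    · rintro ⟨τ, x⟩ h
      simp only [hdoors, hrooms, Finset.coe_sigma, Set.mem_sigma_iff, Finset.mem_coe,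
        Finset.mem_filter, Finset.mem_univ, true_and, mem_completions] at h ⊢
      obtain ⟨⟨-, h2, h3⟩, hx, h4⟩ := h
      refine ⟨⟨h4, ?_⟩, Finset.mem_insert_self x τ, ?_⟩
      · rw [Finset.card_insert_of_notMem hx, h2]
      · rw [Finset.erase_insert hx, h3]
    · rintro ⟨S, x⟩ h
      simp only [hdoors, hrooms, Finset.coe_sigma, Set.mem_sigma_iff, Finset.mem_coe,
        Finset.mem_filter, Finset.mem_univ, true_and, mem_completions] at h ⊢
      obtain ⟨⟨h1, h2⟩, hx, h3⟩ := h
      refine ⟨⟨fun y => ?_, ?_, h3⟩, Finset.notMem_erase x S, ?_⟩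
      · obtain ⟨i, hi⟩ := h1 y
        exact ⟨i, fun z hz => hi z (Finset.mem_of_mem_erase hz)⟩
      · rw [Finset.card_erase_of_mem hx]
        omega
      · rwa [Finset.insert_erase hx]
    · rintro ⟨τ, x⟩ h
      simp only [Finset.coe_sigma, Set.mem_sigma_iff, Finset.mem_coe, mem_completions] at h
      simp [Finset.erase_insert h.2.1]
    · rintro ⟨S, x⟩ h
      simp only [Finset.coe_sigma, Set.mem_sigma_iff, Finset.mem_coe, Finset.mem_filter] at h
      simp [Finset.insert_erase h.2.1]
  have heven : Even (∑ τ ∈ doors, (completions r τ).card) := by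
    rw [hcount]
    refine Finset.even_sum _ fun S hS => ?_
    rw [hrooms, Finset.mem_filter_univ] at hS
    exact even_card_erase_image_eq hS.2 (hno S hS.1)
  rw [← Finset.add_sum_erase _ _ hmem₀, hτ₀, card_completions_image_erase hr ha hinj hw i₀,
    ← hτ₀] at heven
  have heven' : Even (∑ τ ∈ doors.erase τ₀, (completions r τ).card) := by
    refine Finset.even_sum _ fun τ hτ => ?_
    obtain ⟨hne, hτ⟩ := Finset.mem_erase.1 hτ
    rw [hdoors, Finset.mem_filter_univ] at hτ
    obtain ⟨hdom, hcard, himg⟩ := hτ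
    by_cases h : ∃ p ∈ τ, p ∉ Set.range a
    · obtain ⟨p, hp, hpa⟩ := h
      exact even_card_completions hr ha hdom hcard hp hpa
    · push Not at h
      refine absurd (Finset.eq_of_subset_of_card_le (fun x hx => ?_) (by omega)) hne
      obtain ⟨q, rfl⟩ := h x hx
      have := Finset.mem_image_of_mem c hx
      rw [himg, hc] at this
      exact Finset.mem_image_of_mem a this
  obtain ⟨u, hu⟩ := heven
  obtain ⟨v, hv⟩ := heven'
  omega

/-- Scarf's lemma on the grid of nonnegative integer vectors with sum `N`, ordered by their
coordinates. -/
theorem exists_grid_dominant [Fintype I] [Nontrivial I] [DecidableEq I] (N : ℕ)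
    (c : (I → ℕ) → I) :
    ∃ (C : Finset I) (A : Finset (I → ℕ)), A ⊆ Finset.piAntidiag Finset.univ N ∧
      (∀ v ∈ Finset.piAntidiag Finset.univ N, ∃ i ∈ C, ∀ w ∈ A, v i ≤ w i) ∧
      ∀ i ∈ C, ∃ v ∈ A, c v = i := by
  classical
  set V : Finset (I → ℕ) := Finset.piAntidiag Finset.univ N with hV
  have hbound : ∀ v ∈ V, ∀ i, v i ≤ N := by
    intro v hv i
    rw [hV, Finset.mem_piAntidiag] at hv
    rw [← hv.1]
    exact Finset.single_le_sum (fun _ _ => Nat.zero_le _) (Finset.mem_univ i)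
  obtain ⟨i₀⟩ : Nonempty I := inferInstance
  have hw : Pi.single i₀ N ∈ V := by
    rw [hV, Finset.mem_piAntidiag]
    simp
  let e := Fintype.equivFin V
  let g := Fintype.equivFin I
  let r : I → V ⊕ I → ℤ ×ₗ ℕ := fun i => Sum.elim
    (fun v => toLex ((v.1 i : ℤ), (e v : ℕ)))
    (fun k => if k = i then toLex (-1, 0) else toLex ((N : ℤ) + 1, (g k : ℕ)))
  have hr : ∀ i, Function.Injective (r i) := by
    rintro i (v | k) (w | l) h
    · have h2 := congrArg (fun z => (ofLex z).2) h
      exact congrArg Sum.inl (e.injective (Fin.ext h2))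
    · have h1 := congrArg (fun z => (ofLex z).1) h
      have := hbound v.1 v.2 i
      by_cases hl : l = i
      · simp [r, hl] at h1
      · simp [r, hl] at h1
        omega
    · have h1 := congrArg (fun z => (ofLex z).1) h
      have := hbound w.1 w.2 i
      by_cases hk : k = i
      · simp [r, hk] at h1
      · simp [r, hk] at h1
        omega
    · have h1 := congrArg (fun z => (ofLex z).1) h
      have h2 := congrArg (fun z => (ofLex z).2) h
      by_cases hk : k = i <;> by_cases hl : l = i <;> simp [r, hk, hl] at h1 h2
      · rw [hk, hl]
      · omega
      · omega
      · exact congrArg Sum.inr (g.injective (Fin.ext h2))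
  have ha : IsIdeal r (Sum.inr : I → V ⊕ I) := by
    refine ⟨?_, ?_⟩
    · rintro i (v | k)
      · simp only [r, Sum.elim_inr, Sum.elim_inl, if_true, Prod.Lex.toLex_le_toLex]
        left
        omega
      · by_cases hk : k = i
        · rw [hk]
        · simp only [r, Sum.elim_inr, if_true, if_neg hk, Prod.Lex.toLex_le_toLex]
          left
          omega
    · rintro i k (v | l) hx hk
      · have := hbound v.1 v.2 i
        simp only [r, Sum.elim_inr, Sum.elim_inl, if_neg hk, Prod.Lex.toLex_lt_toLex]
        left
        omega
      · exact (hx ⟨l, rfl⟩).elim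
  obtain ⟨S, hS, hcS⟩ := exists_dominant_image_eq_univ hr ha
    (w := Sum.inl ⟨_, hw⟩) (by simp) (c := Sum.elim (fun v => c v.1) id) (fun i => rfl)
  refine ⟨({i | Sum.inr i ∉ S} : Finset I), V.filter fun v => ∃ h : v ∈ V, Sum.inl ⟨v, h⟩ ∈ S,
    Finset.filter_subset _ _, fun v hv => ?_, fun i hi => ?_⟩
  · obtain ⟨i, hi⟩ := hS (Sum.inl ⟨v, hv⟩)
    refine ⟨i, ?_, fun w hw => ?_⟩
    · rw [Finset.mem_filter_univ]
      intro hiS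
      have := hi _ hiS
      simp only [r, Sum.elim_inr, Sum.elim_inl, if_true, Prod.Lex.toLex_le_toLex] at this
      omega
    · obtain ⟨-, hwV, hwS⟩ := Finset.mem_filter.1 hw
      have := hi _ hwS
      simp only [r, Sum.elim_inl, Prod.Lex.toLex_le_toLex] at this
      omega
  · rw [Finset.mem_filter_univ] at hi
    obtain ⟨x, hx, hxi⟩ := Finset.mem_image.1 (hcS ▸ Finset.mem_univ i)
    rcases x with v | k
    · exact ⟨v.1, Finset.mem_filter.2 ⟨v.2, v.2, hx⟩, hxi⟩
    · exact (hi (by rwa [← show k = i from hxi])).elim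

theorem exists_grid_cluster [Fintype I] [Nontrivial I] [DecidableEq I] (N : ℕ)
    (c : (I → ℕ) → I) :
    ∃ (C : Finset I) (A : Finset (I → ℕ)), A ⊆ Finset.piAntidiag Finset.univ N ∧ A.Nonempty ∧
      (∀ i ∈ C, ∃ v ∈ A, c v = i) ∧ (∀ v ∈ A, ∀ w ∈ A, ∀ i, v i ≤ w i + Fintype.card I) ∧
      ∀ v ∈ A, ∀ i ∉ C, v i ≤ Fintype.card I := by
  obtain ⟨C, A, hA, hdom, hcol⟩ := exists_grid_dominant N c
  obtain ⟨i₀⟩ : Nonempty I := inferInstance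
  have hne : A.Nonempty := by
    obtain ⟨i, hi, -⟩ := hdom (Pi.single i₀ N) (by rw [Finset.mem_piAntidiag]; simp)
    obtain ⟨v, hv, -⟩ := hcol i hi
    exact ⟨v, hv⟩
  choose m hm hmin using fun i => Finset.exists_min_image A (fun v => v i) hne
  set b : I → ℕ := fun i => if i ∈ C then m i i else 0 with hb
  have hble : ∀ v ∈ A, ∀ i, b i ≤ v i := by
    intro v hv i
    by_cases hi : i ∈ C
    · simpa [hb, hi] using hmin i v hv
    · simp [hb, hi]
  have hsum : N < ∑ i, (b i + 1) := by
    by_contra! hle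
    obtain ⟨i, hi, hiA⟩ := hdom
      ((fun i => b i + 1) + Pi.single i₀ (N - ∑ i, (b i + 1))) (by
        rw [Finset.mem_piAntidiag]
        refine ⟨?_, by simp⟩
        simp only [Pi.add_apply]
        rw [Finset.sum_add_distrib, Finset.sum_pi_single']
        simp only [Finset.mem_univ, if_true]
        omega)
    have := hiA (m i) (hm i)
    simp only [Pi.add_apply, hb, if_pos hi] at this
    omega
  have hupper : ∀ v ∈ A, ∀ i, v i ≤ b i + Fintype.card I := by
    intro v hv i
    have h1 : ∑ k, v k = N := (Finset.mem_piAntidiag.1 (hA hv)).1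
    have h2 : ∑ k, (v k - b k) + ∑ k, b k = ∑ k, v k := by
      rw [← Finset.sum_add_distrib]
      exact Finset.sum_congr rfl fun k _ => Nat.sub_add_cancel (hble v hv k)
    have h3 : v i - b i ≤ ∑ k, (v k - b k) :=
      Finset.single_le_sum (f := fun k => v k - b k) (fun _ _ => Nat.zero_le _) (Finset.mem_univ i)
    rw [Finset.sum_add_distrib] at hsum
    simp only [Finset.sum_const, Finset.card_univ, smul_eq_mul, mul_one] at hsum
    omega
  refine ⟨C, A, hA, hne, hcol, fun v hv w hw i => ?_, fun v hv i hi => ?_⟩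
  · have := hupper v hv i
    have := hble w hw i
    omega
  · simpa [hb, hi] using hupper v hv i

end Scarf

theorem exists_approx_fixed_point_stdSimplex {I : Type*} [Fintype I] [Nontrivial I]
    {f : (I → ℝ) → I → ℝ} (hmap : Set.MapsTo f (stdSimplex ℝ I) (stdSimplex ℝ I))
    (hf : ContinuousOn f (stdSimplex ℝ I)) {ε : ℝ} (hε : 0 < ε) :
    ∃ x ∈ stdSimplex ℝ I, ∀ i, x i - f x i ≤ ε := by
  classical
  have huc := (isCompact_stdSimplex ℝ I).uniformContinuousOn_of_continuous hf
  obtain ⟨δ, hδ, hfδ⟩ := Metric.uniformContinuousOn_iff.1 huc (ε / 2) (half_pos hε)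
  set n : ℝ := (Fintype.card I : ℝ) with hn
  have hn0 : 0 ≤ n := Nat.cast_nonneg _
  obtain ⟨N, hN⟩ := exists_nat_gt (n / min (δ / 2) (ε / 2))
  have hmin : 0 < min (δ / 2) (ε / 2) := by positivity
  have hN0 : (0 : ℝ) < N := (div_nonneg hn0 hmin.le).trans_lt hN
  have hnN : n / N < min (δ / 2) (ε / 2) := by
    rw [div_lt_iff₀ hmin] at hN
    rw [div_lt_iff₀ hN0]
    linarith
  have hnδ : n / N < δ / 2 := hnN.trans_le (min_le_left _ _)
  have hnε : n / N < ε / 2 := hnN.trans_le (min_le_right _ _)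
  set p : (I → ℕ) → I → ℝ := fun v i => v i / N with hp
  have hpmem : ∀ v ∈ Finset.piAntidiag Finset.univ N, p v ∈ stdSimplex ℝ I := by
    intro v hv
    refine ⟨fun i => by positivity, ?_⟩
    simp only [hp]
    rw [← Finset.sum_div, ← Nat.cast_sum, (Finset.mem_piAntidiag.1 hv).1, div_self hN0.ne']
  have hcol : ∀ v : I → ℕ, ∃ i, p v ∈ stdSimplex ℝ I → p v i ≤ f (p v) i := by
    intro v
    by_cases hv : p v ∈ stdSimplex ℝ I
    · obtain ⟨i, -, hi⟩ := Finset.exists_le_of_sum_le (s := Finset.univ) Finset.univ_nonempty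
        (f := p v) (g := f (p v)) (by rw [hv.2, (hmap hv).2])
      exact ⟨i, fun _ => hi⟩
    · exact ⟨Classical.arbitrary I, fun h => (hv h).elim⟩
  choose c hc using hcol
  obtain ⟨C, A, hA, ⟨v, hv⟩, hcC, hclose, hsmall⟩ := Scarf.exists_grid_cluster N c
  have hdist : ∀ v ∈ A, ∀ w ∈ A, ∀ i, p v i - p w i ≤ n / N := by
    intro v hv w hw i
    simp only [hp]
    rw [← sub_div]
    gcongr
    have : (v i : ℝ) ≤ w i + n := by rw [hn]; exact_mod_cast hclose v hv w hw i
    linarith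
  have hx := hpmem v (hA hv)
  refine ⟨p v, hx, fun i => ?_⟩
  by_cases hi : i ∈ C
  · obtain ⟨w, hw, rfl⟩ := hcC i hi
    have hy := hpmem w (hA hw)
    have hvw : dist (p v) (p w) < δ := by
      refine lt_of_le_of_lt ((dist_pi_le_iff (by positivity)).2 fun k => ?_)
        (hnδ.trans (half_lt_self hδ))
      rw [Real.dist_eq, abs_le]
      constructor <;> linarith [hdist v hv w hw k, hdist w hw v hv k]
    have h1 := (dist_le_pi_dist (f (p v)) (f (p w)) (c w)).trans_lt (hfδ _ hx _ hy hvw)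
    rw [Real.dist_eq, abs_lt] at h1
    linarith [hc w hy, hdist v hv w hw (c w), h1.1]
  · have h1 : p v i ≤ n / N := by
      simp only [hp]
      gcongr
      rw [hn]
      exact_mod_cast hsmall v hv i hi
    linarith [(hmap hx).1 i]

/-- **Brouwer's fixed point theorem** on the standard simplex. -/
theorem exists_fixed_point_stdSimplex {I : Type*} [Fintype I] [Nontrivial I]
    {f : (I → ℝ) → I → ℝ} (hmap : Set.MapsTo f (stdSimplex ℝ I) (stdSimplex ℝ I))
    (hf : ContinuousOn f (stdSimplex ℝ I)) : ∃ x ∈ stdSimplex ℝ I, f x = x := by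
  classical
  set g : (I → ℝ) → ℝ := fun x => ∑ i, max 0 (x i - f x i) with hg
  have hgc : ContinuousOn g (stdSimplex ℝ I) := by
    refine continuousOn_finsetSum _ fun i _ => continuousOn_const.sup ?_
    exact (continuous_apply i).continuousOn.sub ((continuous_apply i).comp_continuousOn hf)
  obtain ⟨i₀⟩ : Nonempty I := inferInstance
  obtain ⟨x, hx, hmin⟩ := (isCompact_stdSimplex ℝ I).exists_isMinOn
    ⟨_, single_mem_stdSimplex ℝ i₀⟩ hgc
  have hg0 : g x ≤ 0 := by
    refine le_of_forall_pos_le_add fun ε hε => ?_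
    have hn : (0 : ℝ) < Fintype.card I := Nat.cast_pos.2 Fintype.card_pos
    obtain ⟨y, hy, hyε⟩ := exists_approx_fixed_point_stdSimplex hmap hf (div_pos hε hn)
    calc g x ≤ g y := hmin hy
      _ ≤ ∑ _i : I, ε / Fintype.card I :=
        Finset.sum_le_sum fun i _ => max_le (div_pos hε hn).le (hyε i)
      _ = 0 + ε := by
        rw [Finset.sum_const, Finset.card_univ, nsmul_eq_mul, mul_div_cancel₀ _ hn.ne', zero_add]
  have hle : ∀ i, x i ≤ f x i := by
    intro i
    have h1 : max 0 (x i - f x i) ≤ g x :=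
      Finset.single_le_sum (f := fun i => max 0 (x i - f x i))
        (fun _ _ => le_max_left _ _) (Finset.mem_univ i)
    linarith [le_max_right 0 (x i - f x i)]
  refine ⟨x, hx, funext fun i => ?_⟩
  exact ((Finset.sum_eq_sum_iff_of_le fun i _ => hle i).1
    (by rw [hx.2, (hmap hx).2]) i (Finset.mem_univ i)).symm

theorem brouwer_cube (m : ℕ) (T : (Fin m → ℝ) → Fin m → ℝ)
    (hmap : ∀ x ∈ Set.Icc (0 : Fin m → ℝ) 1, T x ∈ Set.Icc (0 : Fin m → ℝ) 1)
    (hc : ContinuousOn T (Set.Icc (0 : Fin m → ℝ) 1)) :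
    ∃ x ∈ Set.Icc (0 : Fin m → ℝ) 1, T x = x := by
  rcases Nat.eq_zero_or_pos m with rfl | hm
  · exact ⟨0, ⟨le_rfl, zero_le_one⟩, Subsingleton.elim _ _⟩
  have : Nontrivial (Fin (m + 1)) := Fin.nontrivial_iff_two_le.2 (by omega)
  have hm0 : (0 : ℝ) < m := Nat.cast_pos.2 hm
  -- the cube is a retract of the simplex
  set s : (Fin m → ℝ) → Fin (m + 1) → ℝ := fun x =>
    Fin.cons (1 - ∑ i, x i / m) fun i => x i / m with hs
  set ρ : (Fin (m + 1) → ℝ) → Fin m → ℝ := fun y i => min 1 (m * y i.succ) with hρ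
  have hsc : Continuous s := by
    refine continuous_pi fun i => ?_
    refine Fin.cases ?_ (fun i => ?_) i
    · simp only [hs, Fin.cons_zero]
      fun_prop
    · simp only [hs, Fin.cons_succ]
      fun_prop
  have hρc : Continuous ρ := by fun_prop
  have hρmap : Set.MapsTo ρ (stdSimplex ℝ (Fin (m + 1))) (Set.Icc 0 1) := fun y hy =>
    ⟨fun i => le_min zero_le_one (mul_nonneg hm0.le (hy.1 _)), fun i => min_le_left _ _⟩
  have hsmap : Set.MapsTo s (Set.Icc 0 1) (stdSimplex ℝ (Fin (m + 1))) := by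
    intro x hx
    refine ⟨fun i => ?_, ?_⟩
    · refine Fin.cases ?_ (fun i => ?_) i
      · have : ∑ i, x i / m ≤ ∑ _i : Fin m, 1 / (m : ℝ) :=
          Finset.sum_le_sum fun i _ => div_le_div_of_nonneg_right (hx.2 i) hm0.le
        rw [Finset.sum_const, Finset.card_univ, Fintype.card_fin, nsmul_eq_mul,
          mul_one_div_cancel hm0.ne'] at this
        simpa [hs] using this
      · exact div_nonneg (hx.1 i) hm0.le
    · rw [Fin.sum_univ_succ]
      simp [hs]
  have hρs : ∀ x ∈ Set.Icc (0 : Fin m → ℝ) 1, ρ (s x) = x := by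
    intro x hx
    funext i
    simp only [hρ, hs, Fin.cons_succ]
    rw [mul_div_cancel₀ _ hm0.ne']
    exact min_eq_right (hx.2 i)
  obtain ⟨y, hy, hfix⟩ := exists_fixed_point_stdSimplex (f := fun y => s (T (ρ y)))
    (fun y hy => hsmap (hmap _ (hρmap hy)))
    (hsc.comp_continuousOn (hc.comp hρc.continuousOn hρmap))
  refine ⟨ρ y, hρmap hy, ?_⟩
  conv_rhs => rw [← hfix]
  exact (hρs _ (hmap _ (hρmap hy))).symm
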